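/- Let V be a dissipative cubic stochastic operator on S^{m-1} with coefficients p_{ijl,k}. Then for every i = 1, …, m the vector a_{iii} = (p_{iii,1}, …, p_{iii,m}) satisfies (a_{iii})↓ = e_1; that is, for each i there exists exactly one index k with p_{iii,k} = 1 and p_{iii,j} = 0 for all j ≠ k. -/

import Mathlib

open Finset Filter Topology

/-- Membership in the simplex `S^{m-1}`. -/
def InSimplex {m : ℕ} (x : Fin m → ℝ) : Prop :=
  (∀ i, 0 ≤ x i) ∧ ∑ i, x i = 1

/-- The decreasing rearrangement `x↓` of a vector. -/
noncomputable def dsort {m : ℕ} (x : Fin m → ℝ) : Fin m → ℝ :=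
  fun i => x (Tuple.sort x i.rev)

/-- The sum of the `k` largest coordinates of `x`. -/
noncomputable def topSum {m : ℕ} (x : Fin m → ℝ) (k : ℕ) : ℝ :=
  ∑ i ∈ Finset.univ.filter (fun i : Fin m => (i : ℕ) < k), dsort x i

/-- `Maj x y` means `x ≺ y` : `x` is majorized by `y`. -/
def Maj {m : ℕ} (x y : Fin m → ℝ) : Prop :=
  (∀ k, 1 ≤ k → k ≤ m - 1 → topSum x k ≤ topSum y k) ∧ ∑ i, x i = ∑ i, y i

/-- The `k`-th vertex of the simplex. -/
def vertex {m : ℕ} (k : Fin m) : Fin m → ℝ := fun i => if i = k then 1 else 0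

/-- The quadratic stochastic operator associated to coefficients `p`. -/
def qso {m : ℕ} (p : Fin m → Fin m → Fin m → ℝ) (x : Fin m → ℝ) : Fin m → ℝ :=
  fun k => ∑ i, ∑ j, p i j k * x i * x j

/-- Conditions on the heredity coefficients of a q.s.o. -/
def IsQSO {m : ℕ} (p : Fin m → Fin m → Fin m → ℝ) : Prop :=
  (∀ i j k, 0 ≤ p i j k) ∧ (∀ i j k, p i j k = p j i k) ∧ (∀ i j, ∑ k, p i j k = 1)

/-- The cubic stochastic operator associated to coefficients `p`. -/
def cso {m : ℕ} (p : Fin m → Fin m → Fin m → Fin m → ℝ) (x : Fin m → ℝ) : Fin m → ℝ :=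
  fun k => ∑ i, ∑ j, ∑ l, p i j l k * x i * x j * x l

/-- Conditions on the heredity coefficients of a c.s.o. -/
def IsCSO {m : ℕ} (p : Fin m → Fin m → Fin m → Fin m → ℝ) : Prop :=
  (∀ i j l k, 0 ≤ p i j l k) ∧ (∀ i j l k, p i j l k = p j i l k) ∧
    (∀ i j l k, p i j l k = p i l j k) ∧ (∀ i j l, ∑ k, p i j l k = 1)

lemma topSum_one {m : ℕ} (hm : 0 < m) (x : Fin m → ℝ) :
    topSum x 1 = x (Tuple.sort x (Fin.rev ⟨0, hm⟩)) := by
  have h : Finset.univ.filter (fun i : Fin m => (i : ℕ) < 1) = {⟨0, hm⟩} := by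
    ext i
    simp [Fin.ext_iff]
  rw [topSum, h, Finset.sum_singleton, dsort]

lemma le_topSum_one {m : ℕ} (x : Fin m → ℝ) (i : Fin m) : x i ≤ topSum x 1 := by
  rw [topSum_one i.pos]
  have hle : (Tuple.sort x).symm i ≤ Fin.rev ⟨0, i.pos⟩ := by
    rw [Fin.le_def, Fin.val_rev]
    have := ((Tuple.sort x).symm i).isLt
    simp only
    omega
  simpa using Tuple.monotone_sort x hle

lemma inSimplex_vertex {m : ℕ} (i : Fin m) : InSimplex (vertex i) := by
  refine ⟨fun j => ?_, by simp [vertex]⟩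
  unfold vertex
  split_ifs <;> norm_num

lemma cso_vertex {m : ℕ} (p : Fin m → Fin m → Fin m → Fin m → ℝ) (i : Fin m) :
    cso p (vertex i) = p i i i := by
  ext k
  simp [cso, vertex]

/-- A stochastic vector with a coordinate at least `1` is a vertex of the simplex. -/
lemma InSimplex.eq_one_and_eq_zero {m : ℕ} {x : Fin m → ℝ} (hx : InSimplex x) {k : Fin m}
    (hk : 1 ≤ x k) : x k = 1 ∧ ∀ j, j ≠ k → x j = 0 := by
  have hsplit := Finset.add_sum_erase Finset.univ x (Finset.mem_univ k)
  rw [hx.2] at hsplit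
  have hnonneg : ∀ j ∈ Finset.univ.erase k, 0 ≤ x j := fun j _ => hx.1 j
  have hrest := Finset.sum_nonneg hnonneg
  refine ⟨by linarith, fun j hj => ?_⟩
  exact (Finset.sum_eq_zero_iff_of_nonneg hnonneg).1 (by linarith) j (by simp [hj])

theorem stmt17 (m : ℕ) (p : Fin m → Fin m → Fin m → Fin m → ℝ) (hp : IsCSO p)
    (hdiss : ∀ x, InSimplex x → Maj x (cso p x)) :
    ∀ i, ∃ k, p i i i k = 1 ∧ ∀ j, j ≠ k → p i i i j = 0 := by
  intro i
  have hsimplex : InSimplex (p i i i) := ⟨hp.1 i i i, hp.2.2.2 i i i⟩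
  obtain ⟨k, hk⟩ : ∃ k, topSum (p i i i) 1 = p i i i k := ⟨_, topSum_one i.pos _⟩
  refine ⟨k, hsimplex.eq_one_and_eq_zero ?_⟩
  rcases Nat.lt_or_ge 1 m with hm | hm
  · have hmaj := (hdiss _ (inSimplex_vertex i)).1 1 le_rfl (by omega)
    rw [cso_vertex, hk] at hmaj
    have hvertex := le_topSum_one (vertex i) i
    simp only [vertex, if_true] at hvertex
    exact hvertex.trans hmaj
  · have : Subsingleton (Fin m) := Fin.subsingleton_iff_le_one.2 hm
    have hsum := hsimplex.2
    rw [Fintype.sum_subsingleton _ k] at hsum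
    exact hsum.ge
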